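/- (Lemma 1) Let n, m ≥ 1 and N ≥ 1. Let f : ℝⁿ → ℝⁿ, g : ℝⁿ → ℝ^{n×m}, let Q, Q_f ∈ ℝ^{n×n}, R ∈ ℝ^{m×m} be symmetric, let 𝒳, 𝒳_f ⊆ ℝⁿ, 𝒰 ⊆ ℝᵐ, let P_x, P_u be invertible matrices, t_x ∈ ℝⁿ, t_u ∈ ℝᵐ, and fix x₀ ∈ ℝⁿ. Let J_N(x₀, U) = Σ_{i=0}^{N−1}(x_iᵀQx_i + u_iᵀRu_i) + x_NᵀQ_f x_N along the trajectory x_{i+1} = f(x_i) + g(x_i)u_i with x_0 = x₀, and let J̄_N(ι_x(x₀), Ū) be the corresponding transformed objective Σ_{i=0}^{N−1}(x̄_iᵀQ̄x̄_i + q̄ᵀx̄_i + ū_iᵀR̄ū_i + r̄ᵀū_i) + x̄_NᵀQ̄_f x̄_N + q̄_fᵀx̄_N along x̄_{i+1} = f̄(x̄_i) + ḡ(x̄_i)ū_i with x̄_0 = ι_x(x₀). If Ū* = (ū*_0, …, ū*_{N−1}) minimizes J̄_N(ι_x(x₀), ·) over the feasible input sequences of the transformed problem P-2 (trajectory in ι_x''𝒳,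 inputs in ι_u''𝒰, terminal state in ι_x''𝒳_f), then U* = (P_u⁻¹ū*_0 − t_u, …, P_u⁻¹ū*_{N−1} − t_u) minimizes J_N(x₀, ·) over the feasible input sequences of the original problem P-1 (trajectory in 𝒳, inputs in 𝒰, terminal state in 𝒳_f). -/

import Mathlib

open Matrix

/-- The trajectory of a controlled discrete-time system `x_{k+1} = Φ(x_k, u_k)`
starting from `x0` under the input sequence `U`. -/
def traj {α β : Type*} (Φ : α → β → α) (x0 : α) (U : ℕ → β) : ℕ → α
  | 0 => x0
  | k + 1 => Φ (traj Φ x0 U k) (U k)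

/-- A map intertwining two controlled systems carries trajectories to trajectories. -/
theorem traj_semiconj {α β γ δ : Type*} {Φ : α → β → α} {Ψ : γ → δ → γ} {a : α → γ} {b : β → δ}
    (h : ∀ x u, Ψ (a x) (b u) = a (Φ x u)) (x0 : α) (U : ℕ → β) (i : ℕ) :
    traj Ψ (a x0) (fun k => b (U k)) i = a (traj Φ x0 U i) := by
  induction i with
  | zero => rfl
  | succ k ih => simp only [traj, ih, h]

/-- Completing the square: the masked quadratic cost is the original one up to a constant. -/
theorem affine_mask_quadratic_cost {ι : Type*} [Fintype ι] [DecidableEq ι]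
    {P Q : Matrix ι ι ℝ} (hP : IsUnit P.det) (hQ : Q.IsSymm) (t x : ι → ℝ) :
    P.mulVec (x + t) ⬝ᵥ ((P⁻¹)ᵀ * Q * P⁻¹).mulVec (P.mulVec (x + t)) +
        ((-2 : ℝ) • (P⁻¹)ᵀ.mulVec (Q.mulVec t)) ⬝ᵥ P.mulVec (x + t) =
      x ⬝ᵥ Q.mulVec x - t ⬝ᵥ Q.mulVec t := by
  have hinv : ∀ v : ι → ℝ, P⁻¹.mulVec (P.mulVec v) = v := fun v => by
    rw [mulVec_mulVec, nonsing_inv_mul _ hP, one_mulVec]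
  have hadj : ∀ v w : ι → ℝ, (P⁻¹)ᵀ.mulVec w ⬝ᵥ P.mulVec v = w ⬝ᵥ v := fun v w => by
    rw [mulVec_transpose, ← dotProduct_mulVec, hinv]
  have hsymm : ∀ v w : ι → ℝ, v ⬝ᵥ Q.mulVec w = w ⬝ᵥ Q.mulVec v := fun v w => by
    rw [dotProduct_mulVec, ← mulVec_transpose, hQ.eq, dotProduct_comm]
  rw [← mulVec_mulVec, ← mulVec_mulVec, hinv, dotProduct_comm, hadj, smul_dotProduct, hadj,
    dotProduct_comm (Q.mulVec (x + t)), dotProduct_comm (Q.mulVec t), hsymm (x + t) t]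
  simp only [mulVec_add, dotProduct_add, add_dotProduct, smul_eq_mul, hsymm x t]
  ring

/-- Lemma 1: If `Ū*` minimizes the transformed objective `J̄_N`
over the feasible input sequences of the transformed problem P-2, then
`U* = (P_u⁻¹ū*_0 − t_u, …)` minimizes the original objective `J_N` over the
feasible input sequences of the original problem P-1. -/
theorem affine_mask_optimality_transfer {n m : ℕ} (hn : 1 ≤ n) (hm : 1 ≤ m)
    (N : ℕ) (hN : 1 ≤ N)
    (f : (Fin n → ℝ) → (Fin n → ℝ))
    (g : (Fin n → ℝ) → Matrix (Fin n) (Fin m) ℝ)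
    (Q Qf : Matrix (Fin n) (Fin n) ℝ) (R : Matrix (Fin m) (Fin m) ℝ)
    (hQ : Q.IsSymm) (hQf : Qf.IsSymm) (hR : R.IsSymm)
    (X Xf : Set (Fin n → ℝ)) (Uset : Set (Fin m → ℝ))
    (Px : Matrix (Fin n) (Fin n) ℝ) (Pu : Matrix (Fin m) (Fin m) ℝ)
    (hPx : IsUnit Px.det) (hPu : IsUnit Pu.det)
    (tx : Fin n → ℝ) (tu : Fin m → ℝ) (x0 : Fin n → ℝ)
    (ιx : (Fin n → ℝ) → (Fin n → ℝ)) (hιx : ∀ x, ιx x = Px.mulVec (x + tx))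
    (ιu : (Fin m → ℝ) → (Fin m → ℝ)) (hιu : ∀ u, ιu u = Pu.mulVec (u + tu))
    (ιxinv : (Fin n → ℝ) → (Fin n → ℝ))
    (hιxinv : ∀ xb, ιxinv xb = Px⁻¹.mulVec xb - tx)
    (fbar : (Fin n → ℝ) → (Fin n → ℝ))
    (hfbar : ∀ xb, fbar xb =
      Px.mulVec (f (ιxinv xb) - (g (ιxinv xb)).mulVec tu + tx))
    (gbar : (Fin n → ℝ) → Matrix (Fin n) (Fin m) ℝ)
    (hgbar : ∀ xb, gbar xb = Px * g (ιxinv xb) * Pu⁻¹)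
    (Qbar : Matrix (Fin n) (Fin n) ℝ) (hQbar : Qbar = (Px⁻¹)ᵀ * Q * Px⁻¹)
    (qbar : Fin n → ℝ) (hqbar : qbar = (-2 : ℝ) • (Px⁻¹)ᵀ.mulVec (Q.mulVec tx))
    (Rbar : Matrix (Fin m) (Fin m) ℝ) (hRbar : Rbar = (Pu⁻¹)ᵀ * R * Pu⁻¹)
    (rbar : Fin m → ℝ) (hrbar : rbar = (-2 : ℝ) • (Pu⁻¹)ᵀ.mulVec (R.mulVec tu))
    (Qfbar : Matrix (Fin n) (Fin n) ℝ) (hQfbar : Qfbar = (Px⁻¹)ᵀ * Qf * Px⁻¹)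
    (qfbar : Fin n → ℝ)
    (hqfbar : qfbar = (-2 : ℝ) • (Px⁻¹)ᵀ.mulVec (Qf.mulVec tx))
    (J : (ℕ → Fin m → ℝ) → ℝ)
    (hJ : ∀ U, J U =
      (∑ i ∈ Finset.range N,
        (traj (fun x u => f x + (g x).mulVec u) x0 U i ⬝ᵥ
            Q.mulVec (traj (fun x u => f x + (g x).mulVec u) x0 U i) +
          U i ⬝ᵥ R.mulVec (U i))) +
      traj (fun x u => f x + (g x).mulVec u) x0 U N ⬝ᵥ
        Qf.mulVec (traj (fun x u => f x + (g x).mulVec u) x0 U N))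
    (Jbar : (ℕ → Fin m → ℝ) → ℝ)
    (hJbar : ∀ Ub, Jbar Ub =
      (∑ i ∈ Finset.range N,
        (traj (fun xb ub => fbar xb + (gbar xb).mulVec ub) (ιx x0) Ub i ⬝ᵥ
            Qbar.mulVec
              (traj (fun xb ub => fbar xb + (gbar xb).mulVec ub) (ιx x0) Ub i) +
          qbar ⬝ᵥ traj (fun xb ub => fbar xb + (gbar xb).mulVec ub) (ιx x0) Ub i +
          Ub i ⬝ᵥ Rbar.mulVec (Ub i) + rbar ⬝ᵥ Ub i)) +
      traj (fun xb ub => fbar xb + (gbar xb).mulVec ub) (ιx x0) Ub N ⬝ᵥ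
        Qfbar.mulVec
          (traj (fun xb ub => fbar xb + (gbar xb).mulVec ub) (ιx x0) Ub N) +
      qfbar ⬝ᵥ traj (fun xb ub => fbar xb + (gbar xb).mulVec ub) (ιx x0) Ub N)
    (Feas1 : Set (ℕ → Fin m → ℝ))
    (hFeas1 : Feas1 = {U |
      (∀ i < N, traj (fun x u => f x + (g x).mulVec u) x0 U i ∈ X) ∧
      (∀ i < N, U i ∈ Uset) ∧
      traj (fun x u => f x + (g x).mulVec u) x0 U N ∈ Xf})
    (Feas2 : Set (ℕ → Fin m → ℝ))
    (hFeas2 : Feas2 = {Ub |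
      (∀ i < N,
        traj (fun xb ub => fbar xb + (gbar xb).mulVec ub) (ιx x0) Ub i ∈ ιx '' X) ∧
      (∀ i < N, Ub i ∈ ιu '' Uset) ∧
      traj (fun xb ub => fbar xb + (gbar xb).mulVec ub) (ιx x0) Ub N ∈ ιx '' Xf})
    (Ubstar : ℕ → Fin m → ℝ)
    (hfeas : Ubstar ∈ Feas2)
    (hopt : ∀ Ub ∈ Feas2, Jbar Ubstar ≤ Jbar Ub) :
    (fun i => Pu⁻¹.mulVec (Ubstar i) - tu) ∈ Feas1 ∧
      ∀ U ∈ Feas1, J (fun i => Pu⁻¹.mulVec (Ubstar i) - tu) ≤ J U := by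
  have hux : ∀ v, Px⁻¹.mulVec (Px.mulVec v) = v := fun v => by
    rw [mulVec_mulVec, nonsing_inv_mul _ hPx, one_mulVec]
  have huu : ∀ v, Pu⁻¹.mulVec (Pu.mulVec v) = v := fun v => by
    rw [mulVec_mulVec, nonsing_inv_mul _ hPu, one_mulVec]
  have hux_inj : Function.Injective ιx := fun x y h => by
    have h' := congrArg Px⁻¹.mulVec h
    rwa [hιx, hιx, hux, hux, add_left_inj] at h'
  have huu_inj : Function.Injective ιu := fun x y h => by
    have h' := congrArg Pu⁻¹.mulVec h
    rwa [hιu, hιu, huu, huu, add_left_inj] at h'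
  have hstep : ∀ x u, fbar (ιx x) + (gbar (ιx x)).mulVec (ιu u) =
      ιx (f x + (g x).mulVec u) := fun x u => by
    have hx : ιxinv (ιx x) = x := by rw [hιxinv, hιx, hux, add_sub_cancel_right]
    rw [hfbar, hgbar, hx, hιu, hιx, ← mulVec_mulVec, huu, ← mulVec_mulVec, ← mulVec_add,
      mulVec_add (g x)]
    congr 1
    abel
  have htraj : ∀ U i,
      traj (fun xb ub => fbar xb + (gbar xb).mulVec ub) (ιx x0) (fun k => ιu (U k)) i =
        ιx (traj (fun x u => f x + (g x).mulVec u) x0 U i) :=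
    traj_semiconj hstep x0
  have hfeas_iff : ∀ U, (fun k => ιu (U k)) ∈ Feas2 ↔ U ∈ Feas1 := fun U => by
    simp only [hFeas1, hFeas2, Set.mem_ofPred_eq, htraj, hux_inj.mem_set_image,
      huu_inj.mem_set_image]
  have hcost : ∀ U, Jbar (fun k => ιu (U k)) =
      J U - (N * (tx ⬝ᵥ Q.mulVec tx + tu ⬝ᵥ R.mulVec tu) + tx ⬝ᵥ Qf.mulVec tx) := fun U => by
    have hsum : ∀ a b c d : ℝ, a + b + c + d = a + b + (c + d) := fun a b c d => by ring
    rw [hJbar, hJ, hQbar, hqbar, hRbar, hrbar, hQfbar, hqfbar, add_assoc (Finset.sum _ _)]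
    simp only [htraj, hsum]
    simp only [hιx, hιu,
      affine_mask_quadratic_cost hPx hQ, affine_mask_quadratic_cost hPx hQf,
      affine_mask_quadratic_cost hPu hR, Finset.sum_add_distrib, Finset.sum_sub_distrib,
      Finset.sum_const, Finset.card_range, nsmul_eq_mul]
    ring
  have hstar : (fun k => ιu (Pu⁻¹.mulVec (Ubstar k) - tu)) = Ubstar := by
    funext k
    rw [hιu, sub_add_cancel, mulVec_mulVec, mul_nonsing_inv _ hPu, one_mulVec]
  refine ⟨(hfeas_iff _).1 (by rwa [hstar]), fun U hU => ?_⟩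
  have hle := hopt _ ((hfeas_iff U).2 hU)
  rw [← hstar, hcost, hcost] at hle
  exact (sub_le_sub_iff_right _).1 hle
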